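/- arXiv:1009.0933 — 2 statements merged into one kernel-verified Lean document; each statement's English description precedes it below -/
import Mathlib

section
/- Let V, W : ℝⁿ → ℝⁿ be twice continuously differentiable vector fields. Then pointwise one has the identity ⟨V, ΔW − ∇(div W)⟩ − Δ(⟨V,W⟩) = ⟨W, ΔV − ∇(div V)⟩ − div(V · div W) + div(W · div V) − 2 ∑_{j=1}^n ∂_j ( ∑_{k=1}^n W_k ∂_j V_k ). -/
open scoped RealInnerProductSpace BigOperators

/-- The `j`-th partial derivative of a scalar function on `ℝⁿ`. -/
noncomputable def pd {n : ℕ} (j : Fin n) (f : EuclideanSpace ℝ (Fin n) → ℝ) :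
    EuclideanSpace ℝ (Fin n) → ℝ :=
  fun x => fderiv ℝ f x (EuclideanSpace.single j 1)

/-- The Laplacian `Δ = ∑ⱼ ∂ⱼ²` of a scalar function on `ℝⁿ`. -/
noncomputable def lap {n : ℕ} (f : EuclideanSpace ℝ (Fin n) → ℝ) :
    EuclideanSpace ℝ (Fin n) → ℝ :=
  fun x => ∑ j, pd j (pd j f) x

/-- The divergence `div V = ∑ₖ ∂ₖ Vₖ` of a vector field on `ℝⁿ`. -/
noncomputable def dvg {n : ℕ} (V : EuclideanSpace ℝ (Fin n) → EuclideanSpace ℝ (Fin n)) :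
    EuclideanSpace ℝ (Fin n) → ℝ :=
  fun x => ∑ k, pd k (fun y => V y k) x

theorem pd_mul {n : ℕ} (j : Fin n) {f g : EuclideanSpace ℝ (Fin n) → ℝ}
    {x : EuclideanSpace ℝ (Fin n)} (hf : DifferentiableAt ℝ f x) (hg : DifferentiableAt ℝ g x) :
    pd j (fun y => f y * g y) x = f x * pd j g x + g x * pd j f x := by
  simp [pd, fderiv_fun_mul hf hg]

theorem pd_add {n : ℕ} (j : Fin n) {f g : EuclideanSpace ℝ (Fin n) → ℝ}
    {x : EuclideanSpace ℝ (Fin n)} (hf : DifferentiableAt ℝ f x) (hg : DifferentiableAt ℝ g x) :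
    pd j (fun y => f y + g y) x = pd j f x + pd j g x := by
  simp [pd, fderiv_fun_add hf hg]

theorem pd_sum {n : ℕ} {ι : Type*} (s : Finset ι) (j : Fin n)
    {f : ι → EuclideanSpace ℝ (Fin n) → ℝ} {x : EuclideanSpace ℝ (Fin n)}
    (hf : ∀ i ∈ s, DifferentiableAt ℝ (f i) x) :
    pd j (fun y => ∑ i ∈ s, f i y) x = ∑ i ∈ s, pd j (f i) x := by
  simp [pd, fderiv_fun_sum hf]

theorem ContDiff.differentiable_pd {n : ℕ} (j : Fin n) {f : EuclideanSpace ℝ (Fin n) → ℝ}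
    (hf : ContDiff ℝ 2 f) : Differentiable ℝ (pd j f) := by
  have h : ContDiff ℝ 1 (fderiv ℝ f) := hf.fderiv_right (by norm_num)
  exact (h.differentiable (by norm_num)).clm_apply (differentiable_const _)

theorem differentiable_dvg {n : ℕ} {V : EuclideanSpace ℝ (Fin n) → EuclideanSpace ℝ (Fin n)}
    (hV : ∀ k, ContDiff ℝ 2 fun y => V y k) : Differentiable ℝ (dvg V) :=
  Differentiable.fun_sum fun k _ => (hV k).differentiable_pd k

/-- The Leibniz rule `Δ(fg) = f Δg + g Δf + 2 ⟨∇f, ∇g⟩`. -/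
theorem lap_mul {n : ℕ} {f g : EuclideanSpace ℝ (Fin n) → ℝ}
    (hf : ContDiff ℝ 2 f) (hg : ContDiff ℝ 2 g) (x : EuclideanSpace ℝ (Fin n)) :
    lap (fun y => f y * g y) x
      = f x * lap g x + g x * lap f x + 2 * ∑ j, pd j f x * pd j g x := by
  have df := hf.differentiable two_ne_zero
  have dg := hg.differentiable two_ne_zero
  simp only [lap, Finset.mul_sum, ← Finset.sum_add_distrib]
  refine Finset.sum_congr rfl fun j _ => ?_
  have e : pd j (fun y => f y * g y) = fun y => f y * pd j g y + g y * pd j f y :=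
    funext fun y => pd_mul j (df y) (dg y)
  have df' := hf.differentiable_pd j
  have dg' := hg.differentiable_pd j
  rw [e, pd_add j ((df x).fun_mul (dg' x)) ((dg x).fun_mul (df' x)), pd_mul j (df x) (dg' x),
    pd_mul j (dg x) (df' x)]
  ring

theorem lap_sum {n : ℕ} {ι : Type*} (s : Finset ι) {f : ι → EuclideanSpace ℝ (Fin n) → ℝ}
    (hf : ∀ i ∈ s, ContDiff ℝ 2 (f i)) (x : EuclideanSpace ℝ (Fin n)) :
    lap (fun y => ∑ i ∈ s, f i y) x = ∑ i ∈ s, lap (f i) x := by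
  simp only [lap]
  rw [Finset.sum_comm]
  refine Finset.sum_congr rfl fun j _ => ?_
  have e : pd j (fun y => ∑ i ∈ s, f i y) = fun y => ∑ i ∈ s, pd j (f i) y :=
    funext fun y => pd_sum s j fun i hi => (hf i hi).differentiable two_ne_zero y
  rw [e, pd_sum s j fun i hi => (hf i hi).differentiable_pd j x]

/-- The product rule `div(f V) = f div V + ⟨V, ∇f⟩`. -/
theorem dvg_smul {n : ℕ} {f : EuclideanSpace ℝ (Fin n) → ℝ}
    {V : EuclideanSpace ℝ (Fin n) → EuclideanSpace ℝ (Fin n)} {x : EuclideanSpace ℝ (Fin n)}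
    (hf : DifferentiableAt ℝ f x) (hV : ∀ k, DifferentiableAt ℝ (fun y => V y k) x) :
    dvg (fun y => f y • V y) x = f x * dvg V x + ∑ k, V x k * pd k f x := by
  simp only [dvg, PiLp.smul_apply, smul_eq_mul, Finset.mul_sum, ← Finset.sum_add_distrib]
  exact Finset.sum_congr rfl fun k _ => pd_mul k hf (hV k)

/-- `⟨V, ΔW − ∇(div W)⟩ − Δ⟨V,W⟩
      = ⟨W, ΔV − ∇(div V)⟩ − div(V·div W) + div(W·div V) − 2∑ⱼ ∂ⱼ(∑ₖ Wₖ ∂ⱼVₖ)`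
for `C²` vector fields `V`, `W` on `ℝⁿ`. -/
theorem elastic_key_identity {n : ℕ}
    (V W : EuclideanSpace ℝ (Fin n) → EuclideanSpace ℝ (Fin n))
    (hV : ContDiff ℝ 2 V) (hW : ContDiff ℝ 2 W) (x : EuclideanSpace ℝ (Fin n)) :
    (∑ i, V x i * (lap (fun y => W y i) x - pd i (dvg W) x))
        - lap (fun y => ⟪V y, W y⟫) x
      = (∑ i, W x i * (lap (fun y => V y i) x - pd i (dvg V) x))
        - dvg (fun y => dvg W y • V y) x
        + dvg (fun y => dvg V y • W y) x
        - 2 * ∑ j, pd j (fun y => ∑ k, W y k * pd j (fun z => V z k) y) x := by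
  have cV : ∀ k, ContDiff ℝ 2 fun y => V y k := contDiff_euclidean.1 hV
  have cW : ∀ k, ContDiff ℝ 2 fun y => W y k := contDiff_euclidean.1 hW
  have dV k := (cV k).differentiable two_ne_zero
  have dW k := (cW k).differentiable two_ne_zero
  have h_inner : lap (fun y => ⟪V y, W y⟫) x
      = ∑ k, V x k * lap (fun y => W y k) x + ∑ k, W x k * lap (fun y => V y k) x
        + 2 * ∑ k, ∑ j, pd j (fun y => V y k) x * pd j (fun y => W y k) x := by
    have e : (fun y => ⟪V y, W y⟫) = fun y => ∑ k, V y k * W y k := by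
      funext y
      simp [PiLp.inner_apply, mul_comm]
    rw [e, lap_sum _ fun k _ => (cV k).mul (cW k), Finset.mul_sum, ← Finset.sum_add_distrib,
      ← Finset.sum_add_distrib]
    exact Finset.sum_congr rfl fun k _ => lap_mul (cV k) (cW k) x
  have h_last : ∑ j, pd j (fun y => ∑ k, W y k * pd j (fun z => V z k) y) x
      = ∑ k, W x k * lap (fun y => V y k) x
        + ∑ k, ∑ j, pd j (fun y => V y k) x * pd j (fun y => W y k) x := by
    simp only [lap, Finset.mul_sum, ← Finset.sum_add_distrib]
    rw [Finset.sum_comm]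
    refine Finset.sum_congr rfl fun j _ => ?_
    rw [pd_sum _ j fun k _ => (dW k x).fun_mul ((cV k).differentiable_pd j x)]
    exact Finset.sum_congr rfl fun k _ => pd_mul j (dW k x) ((cV k).differentiable_pd j x)
  rw [h_inner, h_last, dvg_smul (differentiable_dvg cW x) fun k => dV k x,
    dvg_smul (differentiable_dvg cV x) fun k => dW k x]
  simp only [mul_sub, Finset.sum_sub_distrib]
  ring
end

section
/- Let E be a (nontrivial, complete) real normed space, let t₀ > 0, and let T₀, T₁ : ℝ → (E →L[ℝ] E) be continuous maps into the Banach space of bounded linear operators on E (with the operator norm). Then there exists a unique continuous map T : Set.Icc (−t₀) t₀ → (E →L[ℝ] E) such that for every t ∈ [−t₀, t₀], T(t) + ∫₀ᵗ T₁(t−s) ∘ T(s) ds = −T₀(t), where the integral is the Bochner integral in the Banach space of bounded linear operators on E. -/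
open scoped BigOperators

namespace Volterra

open Set MeasureTheory Function
open scoped Nat NNReal

variable {A : Type*} [NormedRing A] [NormedAlgebra ℝ A] {r : ℝ}

/-- The Volterra operator `u ↦ (t ↦ -f t - ∫₀ᵗ k (t - s) * u s ds)` on continuous functions
on `[-r, r]`, where `u` is extended to `ℝ` by its values at the endpoints. -/
noncomputable def next (hr : -r ≤ r) {f k : ℝ → A} (hf : Continuous f) (hk : Continuous k)
    (u : C(Icc (-r) r, A)) : C(Icc (-r) r, A) where
  toFun t := -f t - ∫ s in (0 : ℝ)..t, k (t - s) * u (projIcc (-r) r hr s)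
  continuous_toFun := by
    refine (hf.comp continuous_subtype_val).neg.sub ?_
    refine intervalIntegral.continuous_parametric_intervalIntegral_of_continuous
      (f := fun (t : Icc (-r) r) (s : ℝ) ↦ k (t - s) * u (projIcc (-r) r hr s)) ?_
      continuous_subtype_val
    have := continuous_projIcc (h := hr)
    unfold Function.uncurry
    fun_prop

theorem next_apply (hr : -r ≤ r) {f k : ℝ → A} (hf : Continuous f) (hk : Continuous k)
    (u : C(Icc (-r) r, A)) (t : Icc (-r) r) :
    next hr hf hk u t = -f t - ∫ s in (0 : ℝ)..t, k (t - s) * u (projIcc (-r) r hr s) :=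
  rfl

/-- If `t ∈ [-r, r]` and `s` lies between `0` and `t`, then `s ∈ [-r, r]`. -/
theorem mem_Icc_of_mem_uIcc {t s : ℝ} (ht : t ∈ Icc (-r) r) (hs : s ∈ uIcc 0 t) :
    s ∈ Icc (-r) r := by
  have hr : 0 ≤ r := by linarith [ht.1, ht.2]
  exact uIcc_subset_Icc ⟨by linarith, hr⟩ ht hs

/-- Time-dependent bound on the distance between the `n`-th iterates of the Volterra operator. -/
theorem dist_iterate_next_apply_le (hr : -r ≤ r) {f k : ℝ → A} (hf : Continuous f)
    (hk : Continuous k) {M : ℝ} (hM : ∀ s ∈ Icc (-r) r, ‖k s‖ ≤ M) (u v : C(Icc (-r) r, A))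
    (n : ℕ) (t : Icc (-r) r) :
    dist ((next hr hf hk)^[n] u t) ((next hr hf hk)^[n] v t) ≤
      (M * |(t : ℝ)|) ^ n / n ! * dist u v := by
  have hM0 : 0 ≤ M := (norm_nonneg _).trans (hM t t.2)
  induction n generalizing t with
  | zero => simpa using ContinuousMap.dist_apply_le_dist t
  | succ n ih =>
    rw [iterate_succ_apply', iterate_succ_apply', dist_eq_norm, next_apply, next_apply,
      sub_sub_sub_cancel_left]
    have hint (w : C(Icc (-r) r, A)) : IntervalIntegrable
        (fun s ↦ k (t - s) * w (projIcc (-r) r hr s)) volume 0 t := by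
      have := continuous_projIcc (h := hr)
      exact Continuous.intervalIntegrable (by fun_prop) _ _
    rw [← intervalIntegral.integral_sub (hint _) (hint _), intervalIntegral.norm_intervalIntegral_eq]
    calc
      _ ≤ ∫ s in uIoc 0 (t : ℝ), M ^ (n + 1) / n ! * dist u v * |s - 0| ^ n := by
        refine norm_integral_le_of_norm_le (Continuous.integrableOn_uIoc (by fun_prop)) ?_
        refine (ae_restrict_mem measurableSet_uIoc).mono fun s hs ↦ ?_
        have hs' : s ∈ uIcc 0 (t : ℝ) := uIoc_subset_uIcc hs
        have hts : (t : ℝ) - s ∈ uIcc 0 (t : ℝ) := by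
          rw [mem_uIcc] at hs' ⊢
          grind
        rw [← mul_sub, projIcc_of_mem hr (mem_Icc_of_mem_uIcc t.2 hs')]
        refine (norm_mul_le _ _).trans ?_
        rw [← dist_eq_norm, dist_comm]
        calc
          _ ≤ M * ((M * |s|) ^ n / n ! * dist u v) :=
            mul_le_mul (hM _ (mem_Icc_of_mem_uIcc t.2 hts)) (ih _) dist_nonneg hM0
          _ = _ := by rw [sub_zero]; ring
      _ = (M * |(t : ℝ)|) ^ (n + 1) / (n + 1)! * dist u v := by
        rw [integral_const_mul, integral_pow_abs_sub_uIoc, sub_zero, Nat.factorial_succ]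
        push_cast
        field_simp
        ring

/-- Some iterate of the Volterra operator is a contraction. -/
theorem exists_contractingWith_iterate_next (hr : -r ≤ r) {f k : ℝ → A} (hf : Continuous f)
    (hk : Continuous k) : ∃ (n : ℕ) (C : ℝ≥0), ContractingWith C (next hr hf hk)^[n] := by
  obtain ⟨M, hM⟩ := isCompact_Icc.exists_bound_of_continuousOn (hk.continuousOn (s := Icc (-r) r))
  have hM0 : 0 ≤ M := (norm_nonneg _).trans (hM r ⟨hr, le_rfl⟩)
  have hr0 : 0 ≤ r := by linarith
  obtain ⟨n, hn⟩ := ((FloorSemiring.tendsto_pow_div_factorial_atTop (M * r)).eventually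
    (gt_mem_nhds zero_lt_one)).exists
  have hC : 0 ≤ (M * r) ^ n / n ! := by positivity
  refine ⟨n, .mk _ hC, hn, LipschitzWith.of_dist_le_mul fun u v ↦ ?_⟩
  refine (ContinuousMap.dist_le (mul_nonneg hC dist_nonneg)).2 fun t ↦ ?_
  refine (dist_iterate_next_apply_le hr hf hk hM u v n t).trans ?_
  gcongr
  exact abs_le.2 t.2

/-- The Volterra operator has exactly one fixed point. -/
theorem existsUnique_isFixedPt_next [CompleteSpace A] (hr : -r ≤ r) {f k : ℝ → A}
    (hf : Continuous f) (hk : Continuous k) : ∃! u, IsFixedPt (next hr hf hk) u := by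
  obtain ⟨n, C, h⟩ := exists_contractingWith_iterate_next hr hf hk
  exact ⟨_, h.isFixedPt_fixedPoint_iterate, fun u hu ↦ h.fixedPoint_unique (hu.iterate n)⟩

end Volterra

/-- Solvability and uniqueness of the Volterra integral equation
`T(t) + ∫₀ᵗ T₁(t−s) ∘ T(s) ds = −T₀(t)` on `[−t₀, t₀]`, for continuous
operator-valued data `T₀, T₁`, among continuous operator-valued unknowns `T`.
(The value of the integrand for `s` outside `[−t₀, t₀]` is irrelevant, since the
integration variable stays in `[−t₀, t₀]`; it is set to `0` by a junk value.) -/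
theorem volterra_integral_equation_existence_uniqueness
    {E : Type*} [NormedAddCommGroup E] [NormedSpace ℝ E] [CompleteSpace E]
    [Nontrivial E] (t₀ : ℝ) (ht₀ : 0 < t₀)
    (T₀ T₁ : ℝ → E →L[ℝ] E) (h₀ : Continuous T₀) (h₁ : Continuous T₁) :
    ∃! T : C(Set.Icc (-t₀) t₀, E →L[ℝ] E),
      ∀ t : Set.Icc (-t₀) t₀,
        T t + ∫ s in (0:ℝ)..(t : ℝ),
            (T₁ ((t : ℝ) - s)).comp
              (if h : s ∈ Set.Icc (-t₀) t₀ then T ⟨s, h⟩ else 0)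
          = -T₀ (t : ℝ) := by
  have hr : -t₀ ≤ t₀ := by linarith
  refine (existsUnique_congr fun T ↦ ?_).1 (Volterra.existsUnique_isFixedPt_next hr h₀ h₁)
  rw [Function.IsFixedPt, ContinuousMap.ext_iff]
  refine forall_congr' fun t ↦ ?_
  have hint : ∫ s in (0 : ℝ)..t, T₁ (t - s) * T (Set.projIcc (-t₀) t₀ hr s) =
      ∫ s in (0 : ℝ)..t, (T₁ (t - s)).comp
        (if h : s ∈ Set.Icc (-t₀) t₀ then T ⟨s, h⟩ else 0) := by
    refine intervalIntegral.integral_congr fun s hs ↦ ?_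
    have hs' := Volterra.mem_Icc_of_mem_uIcc t.2 hs
    simp only [dif_pos hs', Set.projIcc_of_mem hr hs', ContinuousLinearMap.mul_def]
  rw [Volterra.next_apply, hint, sub_eq_iff_eq_add, eq_comm]
end
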